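/- Let 0 < α < 2 and β > 0. There exists a constant C > 0, depending only on α and β, such that for all x ≥ 0, |E_{α,β}(−x)| ≤ C / (1 + x). -/

import Mathlib

/-- The Mittag-Leffler function `E_{a,b}(x) = ∑ xᵏ / Γ(a k + b)` (real version). -/
noncomputable def ML (a b x : ℝ) : ℝ := ∑' k : ℕ, x ^ k / Real.Gamma (a * k + b)

open MeasureTheory Filter Topology

namespace MLaux

lemma laplace_integrable {s c : ℝ} (hs : -1 < s) (hc : 0 < c) :
    IntegrableOn (fun t : ℝ => t ^ s * Real.exp (-(c * t))) (Set.Ioi 0) := by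
  have h := integrableOn_rpow_mul_exp_neg_mul_rpow (p := 1) hs one_pos hc
  simpa using h

lemma laplace_cintegrable {s : ℝ} {r : ℂ} (hs : -1 < s) (hr : 0 < r.re) :
    IntegrableOn (fun t : ℝ => ((t ^ s : ℝ) : ℂ) * Complex.exp (-(r * t))) (Set.Ioi 0) := by
  refine Integrable.mono' (laplace_integrable hs hr) ?_ ?_
  · apply Measurable.aestronglyMeasurable
    fun_prop
  · refine (ae_restrict_iff' measurableSet_Ioi).2 (Eventually.of_forall fun t ht => ?_)
    have ht : 0 < t := ht
    rw [norm_mul, Complex.norm_exp, Complex.norm_real, Real.norm_of_nonneg (by positivity)]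
    simp

lemma laplace_deriv {s : ℝ} {r : ℂ} (hs : 0 < s) (hr : 0 < r.re) :
    HasDerivAt (fun r : ℂ => ∫ t in Set.Ioi (0:ℝ), ((t ^ (s-1) : ℝ) : ℂ) * Complex.exp (-(r * t)))
      (∫ t in Set.Ioi (0:ℝ), ((t ^ (s-1) : ℝ) : ℂ) * (Complex.exp (-(r * t)) * (-t))) r := by
  have hs' : {z : ℂ | r.re / 2 < z.re} ∈ 𝓝 r :=
    (isOpen_lt continuous_const Complex.continuous_re).mem_nhds (by simp; linarith)
  refine (hasDerivAt_integral_of_dominated_loc_of_deriv_le (𝕜 := ℂ)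
    (F := fun (r : ℂ) (t : ℝ) => ((t ^ (s-1) : ℝ) : ℂ) * Complex.exp (-(r * t)))
    (F' := fun (r : ℂ) (t : ℝ) => ((t ^ (s-1) : ℝ) : ℂ) * (Complex.exp (-(r * t)) * (-t))) hs' ?_ ?_ ?_ ?_
    (laplace_integrable (s := s) (c := r.re / 2) (by linarith) (by linarith)) ?_).2
  · refine Eventually.of_forall fun z => ?_
    apply Measurable.aestronglyMeasurable
    fun_prop
  · exact laplace_cintegrable (by linarith) hr
  · apply Measurable.aestronglyMeasurable
    fun_prop
  · refine (ae_restrict_iff' measurableSet_Ioi).2 (Eventually.of_forall fun t ht z hz => ?_)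
    have ht : 0 < t := ht
    have hz : r.re / 2 < z.re := hz
    rw [norm_mul, norm_mul, Complex.norm_exp, Complex.norm_real, Real.norm_of_nonneg (by positivity),
      norm_neg, Complex.norm_real, Real.norm_of_nonneg ht.le]
    have e : t ^ s = t ^ (s-1) * t := by
      rw [← Real.rpow_add_one ht.ne']; simp
    rw [e]
    have : Real.exp (-(z * t)).re ≤ Real.exp (-(r.re / 2 * t)) := by
      apply Real.exp_le_exp.2
      simp
      nlinarith
    calc _ = (t ^ (s-1) * t) * Real.exp (-(z * t)).re := by ring
      _ ≤ _ := by gcongr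
  · refine Eventually.of_forall fun t z _ => ?_
    have h1 : HasDerivAt (fun z : ℂ => -(z * t)) (-(1 * (t:ℂ))) z := ((hasDerivAt_id z).mul_const _).neg
    have := (h1.cexp).const_mul ((t ^ (s-1) : ℝ) : ℂ)
    simpa using this

lemma laplace_eq {s : ℝ} {r : ℂ} (hs : 0 < s) (hr : 0 < r.re) :
    ∫ t in Set.Ioi (0:ℝ), ((t ^ (s-1) : ℝ) : ℂ) * Complex.exp (-(r * t))
      = (Real.Gamma s : ℂ) * r ^ (-(s:ℂ)) := by
  have hopen : IsOpen {z : ℂ | 0 < z.re} := isOpen_lt continuous_const Complex.continuous_re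
  have hf : AnalyticOnNhd ℂ (fun r : ℂ => ∫ t in Set.Ioi (0:ℝ),
      ((t ^ (s-1) : ℝ) : ℂ) * Complex.exp (-(r * t))) {z : ℂ | 0 < z.re} := by
    apply DifferentiableOn.analyticOnNhd _ hopen
    intro z hz
    exact (laplace_deriv hs hz).differentiableAt.differentiableWithinAt
  have hg : AnalyticOnNhd ℂ (fun r : ℂ => (Real.Gamma s : ℂ) * r ^ (-(s:ℂ))) {z : ℂ | 0 < z.re} := by
    apply DifferentiableOn.analyticOnNhd _ hopen
    intro z hz
    apply DifferentiableAt.differentiableWithinAt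
    apply DifferentiableAt.const_mul
    exact differentiableAt_id.cpow_const (Or.inl hz)
  have hpre : IsPreconnected {z : ℂ | 0 < z.re} := (convex_halfSpace_re_gt 0).isPreconnected
  refine hf.eqOn_of_preconnected_of_frequently_eq hg hpre (z₀ := 1) (by simp) ?_ hr
  have hreal : ∀ x : ℝ, 0 < x → (∫ t in Set.Ioi (0:ℝ),
      ((t ^ (s-1) : ℝ) : ℂ) * Complex.exp (-((x:ℂ) * t))) = (Real.Gamma s : ℂ) * (x:ℂ) ^ (-(s:ℂ)) := by
    intro x hx
    have := Real.integral_rpow_mul_exp_neg_mul_Ioi hs hx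
    have h2 : (∫ t in Set.Ioi (0:ℝ), ((t ^ (s-1) : ℝ) : ℂ) * Complex.exp (-((x:ℂ) * t)))
      = ((∫ t in Set.Ioi (0:ℝ), t ^ (s-1) * Real.exp (-(x * t)) : ℝ) : ℂ) := by
      rw [← integral_complex_ofReal]
      congr 1
      ext t
      push_cast
      rfl
    rw [h2, this, ← Complex.ofReal_neg, ← Complex.ofReal_cpow hx.le, ← Complex.ofReal_mul, one_div,
      Real.inv_rpow hx.le, Real.rpow_neg hx.le, mul_comm]
  have ht : Tendsto (fun x : ℝ => (x : ℂ)) (𝓝[>] 1) (𝓝[≠] 1) := by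
    apply tendsto_nhdsWithin_of_tendsto_nhds_of_eventually_within
    · have : Tendsto (fun x : ℝ => (x : ℂ)) (𝓝 1) (𝓝 ((1:ℝ):ℂ)) := Complex.continuous_ofReal.tendsto 1
      simpa using this.mono_left nhdsWithin_le_nhds
    · filter_upwards [self_mem_nhdsWithin] with x hx
      have hx : 1 < x := hx
      simp
      exact_mod_cast hx.ne'
  apply ht.frequently
  apply Eventually.frequently
  filter_upwards [self_mem_nhdsWithin] with x hx
  have hx : 1 < x := hx
  exact hreal x (by linarith)

/-- the point on the vertical line -/
noncomputable def tt (ξ : ℝ) : ℂ := 1 + 2 * Real.pi * ξ * Complex.I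

lemma tt_re (ξ : ℝ) : (tt ξ).re = 1 := by simp [tt]

lemma tt_im (ξ : ℝ) : (tt ξ).im = 2 * Real.pi * ξ := by simp [tt]

lemma tt_ne (ξ : ℝ) : tt ξ ≠ 0 := fun h => by
  have := tt_re ξ; rw [h] at this; simp at this

lemma tt_cont : Continuous tt := by unfold tt; fun_prop

lemma one_le_norm_tt (ξ : ℝ) : 1 ≤ ‖tt ξ‖ := by
  have := Complex.re_le_norm (tt ξ); rwa [tt_re] at this

lemma tt_cpow_cont (w : ℂ) : Continuous (fun ξ => tt ξ ^ w) :=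
  tt_cont.cpow continuous_const (fun ξ => Or.inl (by rw [tt_re]; norm_num))

lemma norm_tt_cpow (ξ s : ℝ) : ‖tt ξ ^ (s : ℂ)‖ = ‖tt ξ‖ ^ s := Complex.norm_cpow_real _ _

lemma integrable_tt {s : ℝ} (hs : 1 < s) : Integrable (fun ξ => tt ξ ^ (-(s:ℂ))) := by
  have h := integrable_rpow_neg_one_add_norm_sq (E := ℝ) (μ := volume) (r := s) (by simpa using hs)
  refine h.mono' (tt_cpow_cont _).aestronglyMeasurable (Eventually.of_forall fun ξ => ?_)
  rw [← Complex.ofReal_neg, norm_tt_cpow]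
  have h1 : (1 + ‖ξ‖ ^ 2) ≤ ‖tt ξ‖ ^ 2 := by
    rw [← Complex.normSq_eq_norm_sq, Complex.normSq_apply, tt_re, tt_im, Real.norm_eq_abs, sq_abs]
    have : 1 ≤ 2 * Real.pi := by linarith [Real.pi_gt_three]
    nlinarith [sq_nonneg ξ, mul_nonneg (sub_nonneg.2 this) (sq_nonneg ξ), mul_self_nonneg (2 * Real.pi * ξ)]
  have h2 : ‖tt ξ‖ ^ (-s) = (‖tt ξ‖ ^ 2) ^ (-s/2) := by
    rw [← Real.rpow_natCast, ← Real.rpow_mul (norm_nonneg _)]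
    congr 1
    push_cast; ring
  rw [h2]
  apply Real.rpow_le_rpow_of_nonpos (by positivity) h1 (by linarith)

lemma inv_Gamma {s : ℝ} (hs : 1 < s) :
    ∫ ξ, Complex.exp (tt ξ) * tt ξ ^ (-(s:ℂ)) = ((Real.Gamma s)⁻¹ : ℝ) := by
  have hG : 0 < Real.Gamma s := Real.Gamma_pos_of_pos (by linarith)
  set f : ℝ → ℂ := (Set.Ioi (0:ℝ)).indicator
    (fun t : ℝ => ((t ^ (s-1) : ℝ) : ℂ) * Complex.exp (-(1 * t))) with hf
  have hfi : Integrable f := by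
    rw [hf, integrable_indicator_iff measurableSet_Ioi]
    exact laplace_cintegrable (by linarith) (by simp)
  have hF : ∀ ξ, FourierTransform.fourier f ξ = (Real.Gamma s : ℂ) * tt ξ ^ (-(s:ℂ)) := by
    intro ξ
    rw [Real.fourier_real_eq_integral_exp_smul, ← laplace_eq (by linarith) (by rw [tt_re]; norm_num),
      ← integral_indicator measurableSet_Ioi]
    congr 1
    ext t
    by_cases ht : t ∈ Set.Ioi (0:ℝ)
    · simp only [hf, Set.indicator_of_mem ht, smul_eq_mul]
      rw [mul_left_comm, ← Complex.exp_add]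
      congr 2
      simp only [tt]; push_cast; ring
    · simp [hf, Set.indicator_of_notMem ht]
  have hFi : Integrable (FourierTransform.fourier f) := by
    have : FourierTransform.fourier f = fun ξ => (Real.Gamma s : ℂ) * tt ξ ^ (-(s:ℂ)) := funext hF
    rw [this]
    exact (integrable_tt hs).const_mul _
  have hc : ContinuousAt f 1 := by
    have : f =ᶠ[𝓝 1] (fun t : ℝ => ((t ^ (s-1) : ℝ) : ℂ) * Complex.exp (-(1 * t))) := by
      filter_upwards [isOpen_Ioi.mem_nhds (show (1:ℝ) ∈ Set.Ioi 0 by simp)] with t ht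
      simp [hf, Set.indicator_of_mem ht]
    rw [continuousAt_congr this]
    apply ContinuousAt.mul
    · exact Complex.continuous_ofReal.continuousAt.comp
        (Real.continuousAt_rpow_const _ _ (Or.inl one_ne_zero))
    · fun_prop
  have key := hfi.fourierInv_fourier_eq hFi hc
  rw [Real.fourierInv_eq'] at key
  have hf1 : f 1 = Complex.exp (-1) := by simp [hf]
  rw [hf1] at key
  have e : ∫ ξ, Complex.exp (tt ξ) * tt ξ ^ (-(s:ℂ)) =
     Complex.exp 1 * (Real.Gamma s : ℂ)⁻¹ * ∫ v : ℝ, Complex.exp (↑(2 * Real.pi * inner ℝ v 1) * Complex.I) • FourierTransform.fourier f v := by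
    rw [← integral_const_mul]
    congr 1
    ext ξ
    rw [hF, smul_eq_mul]
    have : Complex.exp (tt ξ) = Complex.exp 1 * Complex.exp (↑(2 * Real.pi * inner ℝ ξ 1) * Complex.I) := by
      rw [← Complex.exp_add]; simp [tt]
    rw [this]
    have : (Real.Gamma s : ℂ) ≠ 0 := by exact_mod_cast hG.ne'
    field_simp
  rw [e, key, mul_right_comm, ← Complex.exp_add]
  simp

lemma tt_lower {α : ℝ} (h0 : 0 < α) (h2 : α < 2) :
    ∃ c > 0, ∀ ξ x : ℝ, 0 ≤ x → c * x ≤ ‖tt ξ ^ (α:ℂ) + x‖ := by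
  set φ := α * (Real.pi / 2) with hφ
  have hpi := Real.pi_pos
  have hφ0 : 0 < φ := by positivity
  have hφ1 : φ < Real.pi := by nlinarith
  have hs := Real.sin_pos_of_pos_of_lt_pi hφ0 hφ1
  refine ⟨Real.sin φ, hs, fun ξ x hx => ?_⟩
  set r := ‖tt ξ‖ ^ α with hr
  have hr0 : 0 ≤ r := by positivity
  have harg : |(tt ξ).arg| ≤ Real.pi / 2 := Complex.abs_arg_le_pi_div_two_iff.2 (by rw [tt_re]; norm_num)
  set ψ := α * (tt ξ).arg with hψ
  have hw : tt ξ ^ (α:ℂ) = r * (Real.cos ψ + Real.sin ψ * Complex.I) := by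
    rw [Complex.cpow_ofReal]; simp [hr, hψ, mul_comm]
  have hcos : Real.cos φ ≤ Real.cos ψ := by
    rw [← Real.cos_abs ψ]
    apply Real.cos_le_cos_of_nonneg_of_le_pi (abs_nonneg _) hφ1.le
    rw [hψ, abs_mul, abs_of_pos h0]
    exact mul_le_mul_of_nonneg_left harg h0.le
  apply le_of_sq_le_sq _ (norm_nonneg _)
  have hre : (tt ξ ^ (α:ℂ) + x).re = r * Real.cos ψ + x := by
    rw [hw]; simp [-Complex.ofReal_cos, -Complex.ofReal_sin]
  have him : (tt ξ ^ (α:ℂ) + x).im = r * Real.sin ψ := by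
    rw [hw]; simp [-Complex.ofReal_cos, -Complex.ofReal_sin]
  rw [← Complex.normSq_eq_norm_sq, Complex.normSq_apply, hre, him]
  have h1 := Real.sin_sq_add_cos_sq ψ
  have h3 := Real.sin_sq_add_cos_sq φ
  have h4 : 0 ≤ r * x * (Real.cos ψ - Real.cos φ) := mul_nonneg (by positivity) (by linarith)
  nlinarith [sq_nonneg (r + x * Real.cos φ), congrArg (· * r^2) h1, congrArg (· * x^2) h3]

end MLaux
namespace MLaux

lemma Gamma_lower {s R : ℝ} (hs : 1 ≤ s) (hR : 0 < R) :
    R ^ (s-1) * Real.exp (-R) ≤ Real.Gamma s := by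
  rw [Real.Gamma_eq_integral (by linarith), ← integral_exp_neg_Ioi, ← integral_const_mul]
  have hi := Real.GammaIntegral_convergent (s := s) (by linarith)
  have hsub : Set.Ioi R ⊆ Set.Ioi 0 := Set.Ioi_subset_Ioi hR.le
  calc _ ≤ ∫ x in Set.Ioi R, Real.exp (-x) * x ^ (s-1) := by
        apply setIntegral_mono_on _ (hi.mono_set hsub) measurableSet_Ioi
        · intro x hx
          have hx : R < x := hx
          rw [mul_comm]
          have : R ^ (s-1) ≤ x ^ (s-1) := Real.rpow_le_rpow hR.le hx.le (by linarith)
          gcongr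
        · have := laplace_integrable (s := 0) (c := 1) (by norm_num) one_pos
          simp at this
          exact (this.mono_set hsub).const_mul _
    _ ≤ _ := by
        apply setIntegral_mono_set hi _ (Eventually.of_forall hsub)
        refine (ae_restrict_iff' measurableSet_Ioi).2 (Eventually.of_forall fun t ht => ?_)
        have ht : 0 < t := ht
        simp only [Pi.zero_apply]
        positivity

lemma summable_coef {α β : ℝ} (hα : 0 < α) (hβ : 0 < β) (r : ℝ) :
    Summable (fun k : ℕ => |r| ^ k / Real.Gamma (α * k + β)) := by
  obtain ⟨R, hR0, hR⟩ : ∃ R : ℝ, 0 < R ∧ R ^ α = 2 * |r| + 1 :=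
    ⟨(2 * |r| + 1) ^ α⁻¹, by positivity, Real.rpow_inv_rpow (by positivity) hα.ne'⟩
  have hgeo : Summable (fun k : ℕ => (R ^ (β - 1) * Real.exp (-R))⁻¹ * (1/2 : ℝ) ^ k) :=
    (summable_geometric_of_lt_one (by norm_num) (by norm_num)).mul_left _
  obtain ⟨N, hN⟩ := exists_nat_ge (1 / α)
  refine (summable_nat_add_iff N).1 ?_
  refine Summable.of_nonneg_of_le (fun k => ?_) (fun k => ?_) ((summable_nat_add_iff N).2 hgeo)
  · have : 0 < Real.Gamma (α * (k + N : ℕ) + β) := Real.Gamma_pos_of_pos (by positivity)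
    positivity
  · have h1 : 1 ≤ α * (k + N : ℕ) + β := by
      have : 1 ≤ α * N := by rw [div_le_iff₀ hα] at hN; linarith
      push_cast
      have : 0 ≤ α * k := by positivity
      nlinarith
    have h2 := Gamma_lower h1 hR0
    have h3 : R ^ (α * (k + N : ℕ) + β - 1) = (2 * |r| + 1) ^ (k + N) * R ^ (β - 1) := by
      rw [add_sub_assoc, Real.rpow_add hR0, Real.rpow_mul hR0.le, hR, Real.rpow_natCast]
    rw [h3] at h2
    have h4 : 0 < R ^ (β - 1) * Real.exp (-R) := by positivity
    rw [div_le_iff₀ (Real.Gamma_pos_of_pos (by linarith))]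
    calc |r| ^ (k+N) = (1/2) ^ (k+N) * (2 * |r|) ^ (k+N) := by rw [← mul_pow]; congr 1; ring
      _ ≤ (1/2) ^ (k+N) * (2 * |r| + 1) ^ (k+N) := by gcongr; linarith
      _ = (R ^ (β - 1) * Real.exp (-R))⁻¹ * (1 / 2) ^ (k + N) *
        ((2 * |r| + 1) ^ (k + N) * R ^ (β - 1) * Real.exp (-R)) := by field_simp
      _ ≤ _ := by gcongr

/-- complex Mittag-Leffler at `-z` -/
noncomputable def G (α β : ℝ) (z : ℂ) : ℂ := ∑' k : ℕ, (-z) ^ k * ((Real.Gamma (α * k + β))⁻¹ : ℝ)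

lemma G_ofReal (α β x : ℝ) : G α β x = ML α β (-x) := by
  rw [G, ML, Complex.ofReal_tsum]
  congr 1; ext k
  push_cast
  rfl

lemma term_bound {α β : ℝ} (hα : 0 < α) (hβ : 0 < β) {R : ℝ} (k : ℕ) (w : ℂ)
    (hw : w ∈ Metric.ball (0:ℂ) R) :
    ‖(-w) ^ k * (((Real.Gamma (α * k + β))⁻¹ : ℝ) : ℂ)‖ ≤ |R| ^ k / Real.Gamma (α * k + β) := by
  have : 0 < Real.Gamma (α * k + β) := Real.Gamma_pos_of_pos (by positivity)
  rw [norm_mul, norm_pow, norm_neg, Complex.norm_real, Real.norm_of_nonneg (by positivity), div_eq_mul_inv]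
  have : ‖w‖ ≤ |R| := by
    simp at hw; exact hw.le.trans (le_abs_self _)
  gcongr

lemma G_diff {α β : ℝ} (hα : 0 < α) (hβ : 0 < β) : Differentiable ℂ (G α β) := by
  intro z
  have h := Complex.differentiableOn_tsum_of_summable_norm (summable_coef hα hβ (‖z‖+1))
    (F := fun (k : ℕ) (w : ℂ) => (-w) ^ k * (((Real.Gamma (α * k + β))⁻¹ : ℝ) : ℂ))
    (U := Metric.ball 0 (‖z‖+1)) (fun k => by fun_prop) Metric.isOpen_ball
    (fun k w hw => term_bound hα hβ k w hw)
  exact h.differentiableAt (Metric.isOpen_ball.mem_nhds (by simp))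

lemma G_summable {α β : ℝ} (hα : 0 < α) (hβ : 0 < β) (z : ℂ) :
    Summable (fun k : ℕ => (-z) ^ k * (((Real.Gamma (α * k + β))⁻¹ : ℝ) : ℂ)) := by
  apply Summable.of_norm_bounded (summable_coef hα hβ (‖z‖+1))
  intro k
  exact term_bound hα hβ k z (by simp)

lemma G_step {α β : ℝ} (hα : 0 < α) (hβ : 0 < β) (z : ℂ) :
    G α β z = α * z * deriv (G α (β+1)) z + β * G α (β+1) z := by
  have hβ1 : 0 < β + 1 := by linarith
  have h := Complex.hasSum_deriv_of_summable_norm (summable_coef hα hβ1 (‖z‖+1))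
    (F := fun (k : ℕ) (w : ℂ) => (-w) ^ k * (((Real.Gamma (α * k + (β+1)))⁻¹ : ℝ) : ℂ))
    (U := Metric.ball 0 (‖z‖+1)) (z := z) (fun k => by fun_prop) Metric.isOpen_ball
    (fun k w hw => term_bound hα hβ1 k w hw) (by simp)
  have h' := (h.mul_left ((α:ℂ) * z)).add ((G_summable hα hβ1 z).hasSum.mul_left (β:ℂ))
  have e : G α (β+1) = fun w => ∑' k : ℕ, (-w) ^ k * (((Real.Gamma (α * k + (β+1)))⁻¹ : ℝ) : ℂ) := rfl
  have e2 : G α β z = α * z * deriv (fun w => ∑' k : ℕ, (-w) ^ k * (((Real.Gamma (α * k + (β+1)))⁻¹ : ℝ) : ℂ)) z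
     + β * ∑' k : ℕ, (-z) ^ k * (((Real.Gamma (α * k + (β+1)))⁻¹ : ℝ) : ℂ) := by
    rw [← h'.tsum_eq, G]
    congr 1; ext k
    have hd : deriv (fun w : ℂ => (-w) ^ k * (((Real.Gamma (α * k + (β+1)))⁻¹ : ℝ) : ℂ)) z
       = (k * (-z) ^ (k-1) * (-1)) * (((Real.Gamma (α * k + (β+1)))⁻¹ : ℝ) : ℂ) :=
      (((hasDerivAt_neg z).pow k).mul_const _).deriv
    rw [hd]
    have hz : z * (k * (-z) ^ (k-1) * (-1)) = k * (-z) ^ k := by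
      rcases k with _ | k
      · simp
      · simp [pow_succ]; ring
    have hpos : 0 < α * k + β := by positivity
    have hG : Real.Gamma (α * k + (β + 1)) = (α * k + β) * Real.Gamma (α * k + β) := by
      rw [← add_assoc, Real.Gamma_add_one hpos.ne']
    have hc : (((Real.Gamma (α * k + β))⁻¹ : ℝ) : ℂ) =
        ((α * k + β : ℝ) : ℂ) * (((Real.Gamma (α * k + (β+1)))⁻¹ : ℝ) : ℂ) := by
      rw [← Complex.ofReal_mul, hG]
      congr 1
      have := (Real.Gamma_pos_of_pos hpos).ne'
      field_simp
    rw [hc]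
    push_cast
    linear_combination (-(α:ℂ) * ((Real.Gamma (α * k + (β+1)) : ℂ))⁻¹) * hz
  rw [e2, e]

def sector (ε : ℝ) : Set ℂ := {z | |z.im| < ε * z.re}

lemma sector_re_pos {ε : ℝ} (hε : 0 < ε) {z : ℂ} (hz : z ∈ sector ε) : 0 < z.re := by
  have h : |z.im| < ε * z.re := hz
  by_contra hn
  have := abs_nonneg z.im
  nlinarith

/-- the inductive bound -/
def P (α β : ℝ) : Prop := ∃ ε > 0, ∃ C > 0, ∀ z ∈ sector ε, ‖G α β z‖ ≤ C / z.re

lemma P_step {α β : ℝ} (hα : 0 < α) (hβ : 0 < β) (h : P α (β+1)) : P α β := by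
  obtain ⟨ε, hε, C, hC, hb⟩ := h
  set δ := min (ε / (2 * (1 + ε))) (1/2) with hδ
  have hδ0 : 0 < δ := by positivity
  have hδ1 : δ * (1 + ε) ≤ ε / 2 := by
    have : δ ≤ ε / (2 * (1 + ε)) := min_le_left _ _
    calc δ * (1+ε) ≤ ε / (2 * (1 + ε)) * (1+ε) := by gcongr
      _ = ε / 2 := by field_simp
  have hδ2 : δ ≤ 1/2 := min_le_right _ _
  refine ⟨ε / 2, by positivity, α * (1 + ε) * (2 * C / δ) + β * C, by positivity, fun z hz => ?_⟩
  have hx := sector_re_pos (by positivity) hz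
  have hz' : |z.im| < ε / 2 * z.re := hz
  have hzn : ‖z‖ ≤ (1 + ε) * z.re := by
    have := Complex.norm_le_abs_re_add_abs_im z
    rw [abs_of_pos hx] at this
    nlinarith
  have hd : ‖deriv (G α (β+1)) z‖ ≤ (2 * C / z.re) / (δ * z.re) := by
    apply Complex.norm_deriv_le_of_forall_mem_sphere_norm_le (by positivity)
      (G_diff hα (by linarith)).diffContOnCl
    intro w hw
    have hw' : ‖w - z‖ = δ * z.re := by simpa using hw
    have h1 := (Complex.abs_re_le_norm (w - z)).trans hw'.le
    have h2 := (Complex.abs_im_le_norm (w - z)).trans hw'.le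
    simp only [Complex.sub_re, Complex.sub_im] at h1 h2
    have h3 := (abs_le.1 h1).1
    have h4 : z.re / 2 ≤ w.re := by nlinarith
    have h5 : |w.im| < ε * w.re := by
      have : |w.im| ≤ |w.im - z.im| + |z.im| := by
        simpa using abs_add_le (w.im - z.im) z.im
      nlinarith
    refine (hb w h5).trans ?_
    rw [div_le_div_iff₀ (by linarith) hx]
    nlinarith
  have hg := hb z (by
    show |z.im| < ε * z.re
    nlinarith)
  rw [G_step hα hβ]
  calc _ ≤ α * ‖z‖ * ‖deriv (G α (β+1)) z‖ + β * ‖G α (β+1) z‖ := by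
        refine (norm_add_le _ _).trans ?_
        simp [abs_of_pos hα, abs_of_pos hβ]
    _ ≤ α * ((1 + ε) * z.re) * ((2 * C / z.re) / (δ * z.re)) + β * (C / z.re) := by gcongr
    _ = _ := by field_simp

lemma P_base {α β : ℝ} (hα : 0 < α) (hα2 : α < 2) (hβ : 1 + α < β) : P α β := by
  obtain ⟨c, hc, hlow⟩ := tt_lower hα hα2
  set ε := c / 2 with hε
  have hε0 : 0 < ε := by positivity
  set L : ℝ → ℂ := fun ξ => Complex.exp (tt ξ) * tt ξ ^ (-((β - α : ℝ) : ℂ)) with hL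
  set v : ℝ → ℂ := fun ξ => tt ξ ^ (α : ℂ) with hv
  have hLc : Continuous L := (Complex.continuous_exp.comp tt_cont).mul (tt_cpow_cont _)
  have hvc : Continuous v := tt_cpow_cont _
  have hLi : Integrable L := by
    refine (integrable_tt (s := β - α) (by linarith)).bdd_mul (c := Real.exp 1)
      (Complex.continuous_exp.comp tt_cont).aestronglyMeasurable (Eventually.of_forall fun ξ => ?_)
    simp [Complex.norm_exp, tt_re]
  have hv1 : ∀ ξ, 1 ≤ ‖v ξ‖ := fun ξ => by
    simp only [hv]
    rw [norm_tt_cpow]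
    exact Real.one_le_rpow (one_le_norm_tt ξ) hα.le
  have hlow' : ∀ z ∈ sector ε, ∀ ξ, ε * z.re ≤ ‖v ξ + z‖ := by
    intro z hz ξ
    have h1 := hlow ξ z.re (sector_re_pos hε0 hz).le
    have h2 : |z.im| < ε * z.re := hz
    have h3 : v ξ + (z.re : ℂ) = (v ξ + z) - z.im * Complex.I := by
      linear_combination Complex.re_add_im z
    have h4 : ‖v ξ + (z.re : ℂ)‖ ≤ ‖v ξ + z‖ + |z.im| := by
      rw [h3]; refine (norm_sub_le _ _).trans ?_; simp
    have h5 : c * z.re ≤ ‖v ξ + (z.re : ℂ)‖ := h1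
    have : c * z.re = 2 * (ε * z.re) := by rw [hε]; ring
    linarith
  have hopen : IsOpen (sector ε) :=
    isOpen_lt (by fun_prop) (by fun_prop)
  have hne : ∀ z ∈ sector ε, ∀ ξ, v ξ + z ≠ 0 := by
    intro z hz ξ h0
    have := hlow' z hz ξ
    rw [h0, norm_zero] at this
    have := mul_pos hε0 (sector_re_pos hε0 hz)
    linarith
  have hbd : ∀ z ∈ sector ε, ∀ ξ, ‖L ξ / (v ξ + z)‖ ≤ ‖L ξ‖ / (ε * z.re) := by
    intro z hz ξ
    rw [norm_div]
    have := hlow' z hz ξ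
    have := mul_pos hε0 (sector_re_pos hε0 hz)
    gcongr
  have hmeas : ∀ z, AEStronglyMeasurable (fun ξ => L ξ / (v ξ + z)) volume := fun z => by
    apply Measurable.aestronglyMeasurable
    exact hLc.measurable.div (hvc.measurable.add_const _)
  set J : ℂ → ℂ := fun z => ∫ ξ, L ξ / (v ξ + z) with hJ
  have hJd : DifferentiableOn ℂ J (sector ε) := by
    intro z hz
    have hzr := sector_re_pos hε0 hz
    apply DifferentiableAt.differentiableWithinAt
    have hs : sector ε ∩ {w : ℂ | z.re / 2 < w.re} ∈ 𝓝 z :=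
      (hopen.inter (isOpen_lt continuous_const Complex.continuous_re)).mem_nhds
        ⟨hz, by simp; linarith⟩
    refine (hasDerivAt_integral_of_dominated_loc_of_deriv_le (𝕜 := ℂ)
      (F := fun (z : ℂ) (ξ : ℝ) => L ξ / (v ξ + z))
      (F' := fun (z : ℂ) (ξ : ℝ) => - L ξ / (v ξ + z) ^ 2)
      (bound := fun ξ => ‖L ξ‖ / (ε * (z.re / 2)) ^ 2) hs ?_ ?_ ?_ ?_ ?_ ?_).2.differentiableAt
    · exact Eventually.of_forall hmeas
    · exact (hLi.norm.div_const _).mono' (hmeas z) (Eventually.of_forall (hbd z hz))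
    · apply Measurable.aestronglyMeasurable
      exact hLc.measurable.neg.div ((hvc.measurable.add_const _).pow_const 2)
    · refine Eventually.of_forall fun ξ w hw => ?_
      have h1 := hlow' w hw.1 ξ
      have h2 : z.re / 2 < w.re := hw.2
      rw [norm_div, norm_pow, norm_neg]
      have : ε * (z.re / 2) ≤ ‖v ξ + w‖ := le_trans (by gcongr) h1
      gcongr
    · exact hLi.norm.div_const _
    · refine Eventually.of_forall fun ξ w hw => ?_
      have h1 : HasDerivAt (fun z : ℂ => v ξ + z) 1 w := (hasDerivAt_id w).const_add _
      have := (hasDerivAt_const w (L ξ)).fun_div h1 (hne w hw.1 ξ)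
      rw [zero_mul, zero_sub, mul_one] at this
      exact this
  have hsum : ∀ z : ℂ, ‖z‖ < 1 → J z = G α β z := by
    intro z hz
    have hv0 : ∀ ξ, v ξ ≠ 0 := fun ξ h => by have := hv1 ξ; rw [h] at this; simp at this; linarith
    set F : ℕ → ℝ → ℂ := fun k ξ => (-z) ^ k * (L ξ * ((v ξ)⁻¹) ^ (k+1)) with hF
    have hFb : ∀ k ξ, ‖F k ξ‖ ≤ ‖z‖ ^ k * ‖L ξ‖ := by
      intro k ξ
      simp only [hF, norm_mul, norm_pow, norm_neg, norm_inv]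
      have : (‖v ξ‖⁻¹) ^ (k+1) ≤ 1 := pow_le_one₀ (by positivity) (inv_le_one_of_one_le₀ (hv1 ξ))
      have h2 : ‖L ξ‖ * (‖v ξ‖⁻¹) ^ (k+1) ≤ ‖L ξ‖ := mul_le_of_le_one_right (norm_nonneg _) this
      gcongr
    have hFi : ∀ k, Integrable (F k) := by
      intro k
      refine (hLi.norm.const_mul (‖z‖ ^ k)).mono' ?_ (Eventually.of_forall (hFb k))
      apply Measurable.aestronglyMeasurable
      exact (hLc.measurable.mul (hvc.measurable.inv.pow_const _)).const_mul _
    have hS : Summable fun k => ∫ ξ, ‖F k ξ‖ := by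
      refine Summable.of_nonneg_of_le (fun k => integral_nonneg fun ξ => norm_nonneg _) (fun k => ?_)
        ((summable_geometric_of_lt_one (norm_nonneg z) hz).mul_right (∫ ξ, ‖L ξ‖))
      rw [← integral_const_mul]
      exact integral_mono (hFi k).norm (hLi.norm.const_mul _) (hFb k)
    have h := (hasSum_integral_of_summable_integral_norm hFi hS).tsum_eq
    have e1 : ∀ k, ∫ ξ, F k ξ = (-z) ^ k * (((Real.Gamma (α * k + β))⁻¹ : ℝ) : ℂ) := by
      intro k
      rw [← inv_Gamma (by nlinarith [mul_nonneg hα.le (Nat.cast_nonneg (α := ℝ) k)]), ← integral_const_mul]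
      congr 1; ext ξ
      simp only [hF, hL, hv]
      rw [← Complex.cpow_neg, ← Complex.cpow_nat_mul, mul_assoc, ← Complex.cpow_add _ _ (tt_ne ξ)]
      congr 3
      push_cast; ring
    have e2 : ∀ ξ, ∑' k, F k ξ = L ξ / (v ξ + z) := by
      intro ξ
      have hq : ‖-z * (v ξ)⁻¹‖ < 1 := by
        rw [norm_mul, norm_neg, norm_inv]
        exact (mul_le_of_le_one_right (norm_nonneg _) (inv_le_one_of_one_le₀ (hv1 ξ))).trans_lt hz
      have hg := (hasSum_geometric_of_norm_lt_one hq).mul_left (L ξ * (v ξ)⁻¹)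
      have e3 : (fun k => F k ξ) = fun k => L ξ * (v ξ)⁻¹ * (-z * (v ξ)⁻¹) ^ k := by
        ext k; simp only [hF]; rw [mul_pow]; ring
      rw [e3, hg.tsum_eq, mul_assoc, ← mul_inv, div_eq_mul_inv]
      congr 2
      have := hv0 ξ
      field_simp
      ring
    rw [G, hJ]
    simp only [← e2, ← e1]
    exact h.symm
  have hconv : Convex ℝ (sector ε) := by
    intro z hz w hw a b ha hb hab
    have h1 : |z.im| < ε * z.re := hz
    have h2 : |w.im| < ε * w.re := hw
    show |(a • z + b • w).im| < ε * (a • z + b • w).re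
    simp only [Complex.add_im, Complex.add_re, Complex.real_smul, Complex.re_ofReal_mul, Complex.im_ofReal_mul]
    rw [abs_lt] at h1 h2 ⊢
    rcases ha.eq_or_lt with rfl | ha
    · have : b = 1 := by linarith
      subst this
      constructor <;> nlinarith
    · constructor <;> nlinarith
  have hz0 : ((1/2 : ℝ) : ℂ) ∈ sector ε := by
    show |(((1/2 : ℝ) : ℂ)).im| < ε * (((1/2 : ℝ) : ℂ)).re
    rw [Complex.ofReal_im, Complex.ofReal_re]; simp; exact hε0
  have heq : Set.EqOn J (G α β) (sector ε) := by
    refine (hJd.analyticOnNhd hopen).eqOn_of_preconnected_of_eventuallyEq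
      ((G_diff hα (by linarith)).differentiableOn.analyticOnNhd hopen) hconv.isPreconnected hz0 ?_
    filter_upwards [Metric.isOpen_ball.mem_nhds (show ((1/2 : ℝ) : ℂ) ∈ Metric.ball (0:ℂ) 1 by
      rw [mem_ball_zero_iff, Complex.norm_real]; norm_num)] with z hz
    exact hsum z (by simpa using hz)
  refine ⟨ε, hε0, (∫ ξ, ‖L ξ‖) / ε + 1, ?_, fun z hz => ?_⟩
  · have : 0 ≤ ∫ ξ, ‖L ξ‖ := integral_nonneg fun ξ => norm_nonneg _
    positivity
  have hzr := sector_re_pos hε0 hz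
  rw [← heq hz]
  calc ‖J z‖ ≤ ∫ ξ, ‖L ξ‖ / (ε * z.re) :=
        norm_integral_le_of_norm_le (hLi.norm.div_const _) (Eventually.of_forall (hbd z hz))
    _ = (∫ ξ, ‖L ξ‖) / ε / z.re := by rw [integral_div]; field_simp
    _ ≤ _ := by gcongr; linarith

lemma P_all {α β : ℝ} (hα : 0 < α) (hα2 : α < 2) (hβ : 0 < β) : P α β := by
  have key : ∀ n : ℕ, ∀ b : ℝ, 0 < b → 1 + α < b + n → P α b := by
    intro n
    induction n with
    | zero => intro b _ h; exact P_base hα hα2 (by simpa using h)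
    | succ n ih =>
      intro b hb h
      apply P_step hα hb
      apply ih _ (by linarith)
      push_cast at h
      linarith
  obtain ⟨n, hn⟩ := exists_nat_gt (1 + α)
  exact key n β hβ (by linarith)

end MLaux

theorem mittagLeffler_decay (α β : ℝ) (hα0 : 0 < α) (hα2 : α < 2) (hβ : 0 < β) :
    ∃ C : ℝ, 0 < C ∧ ∀ x : ℝ, 0 ≤ x → |ML α β (-x)| ≤ C / (1 + x) := by
  obtain ⟨ε, hε, C, hC, hb⟩ := MLaux.P_all hα0 hα2 hβ
  have habs : ∀ x : ℝ, |ML α β (-x)| = ‖MLaux.G α β x‖ := fun x => by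
    rw [MLaux.G_ofReal, Complex.norm_real, Real.norm_eq_abs]
  have hcont : Continuous fun x : ℝ => MLaux.G α β x :=
    (MLaux.G_diff hα0 hβ).continuous.comp Complex.continuous_ofReal
  obtain ⟨M, hM⟩ := (isCompact_Icc (a := (0:ℝ)) (b := 1)).exists_bound_of_continuousOn hcont.continuousOn
  have hM0 : 0 ≤ M := (norm_nonneg _).trans (hM 0 (by simp))
  refine ⟨2 * (M + C), by positivity, fun x hx => ?_⟩
  rw [habs, le_div_iff₀ (by linarith)]
  rcases le_total x 1 with h1 | h1
  · have := hM x ⟨hx, h1⟩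
    nlinarith [norm_nonneg (MLaux.G α β x)]
  · have hxs : (x : ℂ) ∈ MLaux.sector ε := by
      show |((x:ℂ)).im| < ε * ((x:ℂ)).re
      simp; positivity
    have := hb x hxs
    rw [Complex.ofReal_re, le_div_iff₀ (by linarith)] at this
    nlinarith [norm_nonneg (MLaux.G α β x)]
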